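/- Let α > 0, θ ≥ 1, δ > 0, and let ψ : (0,∞) → [0,∞) be non-negative and non-decreasing with t^{−α}ψ(t) ∈ 𝓛^θ. Define φ₁(t) = (α+δ) t^{α+δ} ∫_t^∞ u^{−α−δ} ψ(u) du/u. Then: (i) t ↦ φ₁(t)t^{−α−δ} is decreasing; (ii) φ₁(t) ≥ ψ(t) for all t > 0; and (iii) ‖t^{−α}φ₁(t)‖_{𝓛^θ} ≤ c‖t^{−α}ψ(t)‖_{𝓛^θ} for a constant c depending only on α, δ and θ. -/

import Mathlib

open MeasureTheory Set
open scoped ENNReal NNReal BigOperators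

noncomputable section

/-- The measure `du/u` on `(0,∞)`. -/
def muLog : Measure ℝ :=
  (volume.restrict (Set.Ioi (0:ℝ))).withDensity fun u => ENNReal.ofReal u⁻¹

/-- The `𝓛^θ` norm of an `ℝ≥0∞`-valued function on `(0,∞)` (with respect to `du/u`),
for `θ ∈ [1,∞]`; for `θ = ∞` it is the essential supremum. -/
def calLE (θ : ℝ≥0∞) (g : ℝ → ℝ≥0∞) : ℝ≥0∞ :=
  if θ = ∞ then essSup g muLog
  else (∫⁻ t, g t ^ θ.toReal ∂muLog) ^ (1 / θ.toReal)

/-- The `𝓛^θ` norm of a real-valued function on `(0,∞)`. -/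
def calL (θ : ℝ≥0∞) (g : ℝ → ℝ) : ℝ≥0∞ :=
  calLE θ fun t => ENNReal.ofReal |g t|

/-- The distribution function `λ_f(y) = |{x : |f x| > y}|`. -/
def distFn {n : ℕ} (f : (Fin n → ℝ) → ℝ) (y : ℝ) : ℝ≥0∞ :=
  volume {x | y < |f x|}

/-- `f ∈ S₀(ℝⁿ)`: measurable with finite distribution function for all `y > 0`. -/
def MemS0 {n : ℕ} (f : (Fin n → ℝ) → ℝ) : Prop :=
  Measurable f ∧ ∀ y : ℝ, 0 < y → distFn f y < ∞

/-- The non-increasing rearrangement `f*`. -/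
def rearr {n : ℕ} (f : (Fin n → ℝ) → ℝ) (t : ℝ) : ℝ :=
  sInf {y : ℝ | 0 ≤ y ∧ distFn f y ≤ ENNReal.ofReal t}

/-- The real-valued `L^p(ℝⁿ)` norm. -/
def lpR {n : ℕ} (p : ℝ) (f : (Fin n → ℝ) → ℝ) : ℝ :=
  (eLpNorm f (ENNReal.ofReal p) volume).toReal

/-- The difference of degree `k` in direction `j` with step `h`:
`Δ_j^k(h) f (x) = ∑ (-1)^{k-i} C(k,i) f(x + i h e_j)`. -/
def diffOp {n : ℕ} (j : Fin n) (k : ℕ) (h : ℝ) (f : (Fin n → ℝ) → ℝ) :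
    (Fin n → ℝ) → ℝ :=
  fun x => ∑ i ∈ Finset.range (k + 1),
    (-1 : ℝ) ^ (k - i) * (k.choose i : ℝ) * f (x + ((i : ℝ) * h) • (Pi.single j 1 : Fin n → ℝ))

/-- The modulus of continuity `ω_j^k(f;δ)_p = sup_{0<h≤δ} ‖Δ_j^k(h) f‖_p`. -/
def modCont {n : ℕ} (j : Fin n) (k : ℕ) (p : ℝ) (f : (Fin n → ℝ) → ℝ) (δ : ℝ) : ℝ :=
  sSup ((fun h => lpR p (diffOp j k h f)) '' Set.Ioc 0 δ)

/-- The directional Besov seminorm `‖f‖_{b^r_{p,θ;j}}` with difference order `k`. -/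
def besov {n : ℕ} (j : Fin n) (k : ℕ) (r p : ℝ) (θ : ℝ≥0∞)
    (f : (Fin n → ℝ) → ℝ) : ℝ≥0∞ :=
  calL θ fun h => h ^ (-r) * lpR p (diffOp j k h f)

/-- The Lorentz quasinorm `‖f‖_{q,s} = ‖t^{1/q} f*(t)‖_{𝓛^s}`. -/
def lorentz {n : ℕ} (q : ℝ) (s : ℝ≥0∞) (f : (Fin n → ℝ) → ℝ) : ℝ≥0∞ :=
  calL s fun t => t ^ (1 / q) * rearr f t

/-- The norm in the sum space `L¹ + L^{p₀}`. -/
def sumNormE {n : ℕ} (p₀ : ℝ) (f : (Fin n → ℝ) → ℝ) : ℝ≥0∞ :=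
  ⨅ (g : (Fin n → ℝ) → ℝ) (h : (Fin n → ℝ) → ℝ) (_ : f = g + h),
    eLpNorm g 1 volume + eLpNorm h (ENNReal.ofReal p₀) volume

/-- The function `σ(t) = inf { max_j t^{-1/p_j} φ_j(δ_j) : δ_j > 0, ∏ δ_j = t }`. -/
def sigmaFn {n : ℕ} (pp : Fin n → ℝ) (φ : Fin n → ℝ → ℝ) (t : ℝ) : ℝ :=
  sInf {a : ℝ | ∃ d : Fin n → ℝ, (∀ j, 0 < d j) ∧ (∏ j, d j) = t ∧
    a = ⨆ j, t ^ (-(pp j)⁻¹) * φ j (d j)}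

lemma calL_eq (θ : ℝ≥0∞) (hθ : 1 ≤ θ) (g : ℝ → ℝ) : calL θ g = eLpNorm g θ muLog := by
  have h0 : θ ≠ 0 := by
    rintro rfl
    simp at hθ
  unfold calL calLE
  split_ifs with h
  · subst h
    simp only [eLpNorm_exponent_top, eLpNormEssSup, Real.enorm_eq_ofReal_abs]
  · rw [eLpNorm_eq_lintegral_rpow_enorm_toReal h0 h]
    simp only [Real.enorm_eq_ofReal_abs]

lemma ae_muLog : ∀ᵐ t ∂muLog, 0 < t := by
  have h : muLog ≪ volume.restrict (Set.Ioi (0:ℝ)) := withDensity_absolutelyContinuous _ _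
  exact h.ae_le (ae_restrict_mem measurableSet_Ioi)

lemma lintegral_muLog {f : ℝ → ℝ≥0∞} (hf : Measurable f) :
    ∫⁻ t, f t ∂muLog = ∫⁻ t in Ioi (0:ℝ), ENNReal.ofReal t⁻¹ * f t := by
  unfold muLog
  rw [lintegral_withDensity_eq_lintegral_mul _ (by fun_prop) hf]
  rfl

lemma muLog_Ioo {t : ℝ} (ht : 0 < t) : ENNReal.ofReal (1/2) ≤ muLog (Ioo t (2*t)) := by
  unfold muLog
  rw [withDensity_apply _ measurableSet_Ioo, Measure.restrict_restrict measurableSet_Ioo]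
  have : Ioo t (2*t) ∩ Ioi 0 = Ioo t (2*t) := by
    ext x; simp only [mem_inter_iff, mem_Ioo, mem_Ioi]; constructor
    · exact fun h => h.1
    · exact fun h => ⟨h, ht.trans h.1⟩
  rw [this]
  calc ENNReal.ofReal (1/2) = ∫⁻ u in Ioo t (2*t), ENNReal.ofReal (2*t)⁻¹ := by
        rw [setLIntegral_const, Real.volume_Ioo, ← ENNReal.ofReal_mul (by positivity)]
        congr 1; field_simp; ring
    _ ≤ _ := by
        apply setLIntegral_mono' measurableSet_Ioo
        intro u hu
        apply ENNReal.ofReal_le_ofReal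
        have : 0 < u := ht.trans hu.1
        gcongr
        exact hu.2.le

lemma bound_psi (α : ℝ) (hα : 0 < α) (θ : ℝ≥0∞) (hθ : 1 ≤ θ) (ψ : ℝ → ℝ)
    (h0 : ∀ t, 0 ≤ ψ t) (hm : Monotone ψ) (hfin : calL θ (fun t => t ^ (-α) * ψ t) < ∞) :
    ∃ K : ℝ, 0 ≤ K ∧ ∀ t, 0 < t → ψ t ≤ K * t ^ α := by
  rw [calL_eq θ hθ] at hfin
  set N := eLpNorm (fun t => t ^ (-α) * ψ t) θ muLog with hN
  have hp0 : θ ≠ 0 := by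
    rintro rfl
    simp at hθ
  set e : ℝ≥0∞ := ENNReal.ofReal (1/2) ^ (1 / θ.toReal) with he
  have he0 : e ≠ 0 := by
    rw [he]
    simp [ENNReal.rpow_eq_zero_iff]
  have key : ∀ t, 0 < t → ENNReal.ofReal ((2*t)^(-α) * ψ t) ≤ N / e := by
    intro t ht
    rw [ENNReal.le_div_iff_mul_le (Or.inl he0) (Or.inr hfin.ne)]
    have hc : 0 ≤ (2*t)^(-α) * ψ t := mul_nonneg (by positivity) (h0 t)
    have hμ := muLog_Ioo ht
    have hμ0 : muLog (Ioo t (2*t)) ≠ 0 := by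
      intro h
      rw [h] at hμ
      simp at hμ
    calc ENNReal.ofReal ((2*t)^(-α) * ψ t) * e
        ≤ ‖(2*t)^(-α) * ψ t‖ₑ * muLog (Ioo t (2*t)) ^ (1 / θ.toReal) := by
          rw [Real.enorm_eq_ofReal hc, he]
          gcongr
      _ = eLpNorm ((Ioo t (2*t)).indicator fun _ => (2*t)^(-α) * ψ t) θ muLog := by
          rw [eLpNorm_indicator_const' measurableSet_Ioo hμ0 hp0]
      _ ≤ N := by
          apply eLpNorm_mono_ae
          filter_upwards [ae_muLog] with u hu
          by_cases h : u ∈ Ioo t (2*t)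
          · rw [indicator_of_mem h, Real.norm_of_nonneg hc,
              Real.norm_of_nonneg (mul_nonneg (by positivity) (h0 u))]
            apply mul_le_mul _ (hm h.1.le) (h0 t) (by positivity)
            exact Real.rpow_le_rpow_of_nonpos hu h.2.le (by linarith)
          · rw [indicator_of_notMem h]
            simp only [norm_zero]
            positivity
  refine ⟨(N / e).toReal * 2 ^ α, by positivity, fun t ht => ?_⟩
  have h1 := (ENNReal.ofReal_le_iff_le_toReal (ENNReal.div_ne_top hfin.ne he0)).1 (key t ht)
  rw [Real.rpow_neg (by positivity), inv_mul_le_iff₀ (by positivity),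
    Real.mul_rpow (by norm_num) ht.le] at h1
  linarith

lemma lint_k {δ t : ℝ} (hδ : 0 < δ) (ht : 0 < t) :
    ∫⁻ u in Ioi t, ENNReal.ofReal (δ * t ^ δ * u ^ (-δ - 1)) = 1 := by
  rw [← ofReal_integral_eq_lintegral_ofReal]
  · rw [integral_const_mul, integral_Ioi_rpow_of_lt (by linarith) ht]
    have : -δ - 1 + 1 = -δ := by ring
    rw [this, Real.rpow_neg ht.le]
    have := Real.rpow_pos_of_pos ht δ
    rw [← ENNReal.ofReal_one]
    congr 1
    field_simp
  · exact (integrableOn_Ioi_rpow_of_lt (by linarith) ht).const_mul _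
  · filter_upwards [ae_restrict_mem measurableSet_Ioi] with u hu
    have : 0 < u := ht.trans hu
    show 0 ≤ _
    positivity

lemma lint_k2 {δ u : ℝ} (hδ : 0 < δ) (hu : 0 < u) :
    ∫⁻ t in Ioo 0 u, ENNReal.ofReal (t ^ (δ - 1)) = ENNReal.ofReal (u ^ δ / δ) := by
  rw [← ofReal_integral_eq_lintegral_ofReal]
  · rw [← integral_Ioc_eq_integral_Ioo, ← intervalIntegral.integral_of_le hu.le,
      integral_rpow (Or.inl (by linarith))]
    simp [Real.zero_rpow hδ.ne']
  · have := (intervalIntegral.intervalIntegrable_rpow' (a := 0) (b := u) (r := δ - 1) (by linarith))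
    rw [intervalIntegrable_iff_integrableOn_Ioo_of_le hu.le] at this
    exact this
  · filter_upwards [ae_restrict_mem measurableSet_Ioo] with t ht
    have : 0 < t := ht.1
    show 0 ≤ _
    positivity

/-- averaging operator -/
def avg (δ : ℝ) (F : ℝ → ℝ) (t : ℝ) : ℝ≥0∞ :=
  ∫⁻ u in Ioi t, ENNReal.ofReal (δ * t ^ δ * u ^ (-δ - 1)) * ‖F u‖ₑ

lemma avg_le {δ t : ℝ} (hδ : 0 < δ) (ht : 0 < t) (F : ℝ → ℝ) (hF : Measurable F)
    (θ : ℝ≥0∞) (hθ : 1 ≤ θ) :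
    avg δ F t ≤ eLpNorm F θ ((volume.restrict (Ioi t)).withDensity
      fun u => ENNReal.ofReal (δ * t ^ δ * u ^ (-δ - 1))) := by
  set ν := (volume.restrict (Ioi t)).withDensity
      fun u => ENNReal.ofReal (δ * t ^ δ * u ^ (-δ - 1)) with hν
  have : IsProbabilityMeasure ν := ⟨by
    rw [hν, withDensity_apply _ MeasurableSet.univ, Measure.restrict_univ, lint_k hδ ht]⟩
  refine le_trans (le_of_eq ?_)
    (eLpNorm_le_eLpNorm_of_exponent_le hθ hF.aestronglyMeasurable)
  rw [eLpNorm_one_eq_lintegral_enorm, hν,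
    lintegral_withDensity_eq_lintegral_mul _ (by fun_prop) hF.enorm]
  rfl

lemma ac_t {δ t : ℝ} (ht : 0 < t) : ((volume.restrict (Ioi t)).withDensity
      fun u => ENNReal.ofReal (δ * t ^ δ * u ^ (-δ - 1))) ≪ muLog := by
  refine (withDensity_absolutelyContinuous _ _).trans ?_
  refine (Measure.absolutelyContinuous_of_le
    (Measure.restrict_mono (Ioi_subset_Ioi ht.le) le_rfl)).trans ?_
  unfold muLog
  refine withDensity_absolutelyContinuous' (by fun_prop) ?_
  filter_upwards [ae_restrict_mem measurableSet_Ioi] with u hu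
  have : 0 < u := hu
  simpa using this

/-- the Tonelli kernel -/
def kern (δ p : ℝ) (F : ℝ → ℝ) (t u : ℝ) : ℝ≥0∞ :=
  if t < u then ENNReal.ofReal (δ * t ^ δ * u ^ (-δ - 1)) * ‖F u‖ₑ ^ p else 0

lemma kern_meas (δ p : ℝ) (F : ℝ → ℝ) (hF : Measurable F) :
    Measurable (fun z : ℝ × ℝ => kern δ p F z.1 z.2) := by
  unfold kern
  exact Measurable.ite (measurableSet_lt measurable_fst measurable_snd) (by fun_prop)
    measurable_const

lemma kern_inner {δ : ℝ} (hδ : 0 < δ) (p : ℝ) (F : ℝ → ℝ) {u : ℝ} (hu : 0 < u) :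
    ∫⁻ t in Ioi (0:ℝ), ENNReal.ofReal t⁻¹ * kern δ p F t u
      = ENNReal.ofReal u⁻¹ * ‖F u‖ₑ ^ p := by
  have h1 : ∫⁻ t in Ioi (0:ℝ), ENNReal.ofReal t⁻¹ * kern δ p F t u
      = ∫⁻ t in Ioi (0:ℝ), (Iio u).indicator (fun t => ENNReal.ofReal (t ^ (δ - 1)) *
          (ENNReal.ofReal (δ * u ^ (-δ - 1)) * ‖F u‖ₑ ^ p)) t := by
    apply setLIntegral_congr_fun measurableSet_Ioi
    intro t ht
    have ht : 0 < t := ht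
    unfold kern
    by_cases h : t < u
    · simp only [h, if_true, indicator, mem_Iio]
      rw [← mul_assoc, ← mul_assoc, ← ENNReal.ofReal_mul (by positivity),
        ← ENNReal.ofReal_mul (by positivity)]
      congr 2
      rw [Real.rpow_sub_one ht.ne']
      field_simp
    · simp [h, indicator]
  rw [h1, setLIntegral_indicator measurableSet_Iio, lintegral_mul_const _ (by fun_prop)]
  have h2 : Iio u ∩ Ioi 0 = Ioo 0 u := by
    ext; simp [and_comm]
  rw [h2, lint_k2 hδ hu, ← mul_assoc, ← ENNReal.ofReal_mul (by positivity)]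
  congr 2
  rw [Real.rpow_sub_one hu.ne', Real.rpow_neg hu.le]
  have := Real.rpow_pos_of_pos hu δ
  field_simp

lemma kern_tonelli {δ : ℝ} (hδ : 0 < δ) (p : ℝ) (F : ℝ → ℝ) (hF : Measurable F) :
    ∫⁻ t, (∫⁻ u in Ioi (0:ℝ), kern δ p F t u) ∂muLog = ∫⁻ u, ‖F u‖ₑ ^ p ∂muLog := by
  have hk := kern_meas δ p F hF
  rw [lintegral_muLog (hk.lintegral_prod_right'), lintegral_muLog (by fun_prop)]
  calc _ = ∫⁻ t in Ioi (0:ℝ), ∫⁻ u in Ioi (0:ℝ), ENNReal.ofReal t⁻¹ * kern δ p F t u := by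
        congr 1; ext t
        exact (lintegral_const_mul _ (hk.comp measurable_prodMk_left)).symm
    _ = ∫⁻ u in Ioi (0:ℝ), ∫⁻ t in Ioi (0:ℝ), ENNReal.ofReal t⁻¹ * kern δ p F t u := by
        apply lintegral_lintegral_swap
        apply Measurable.aemeasurable
        exact Measurable.mul (by fun_prop) hk
    _ = _ := by
        apply setLIntegral_congr_fun measurableSet_Ioi
        intro u hu
        exact kern_inner hδ p F hu

lemma avg_norm {δ : ℝ} (hδ : 0 < δ) (F : ℝ → ℝ) (hF : Measurable F)
    (θ : ℝ≥0∞) (hθ : 1 ≤ θ) :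
    calLE θ (avg δ F) ≤ eLpNorm F θ muLog := by
  unfold calLE
  split_ifs with h
  · subst h
    refine essSup_le_of_ae_le _ ?_
    filter_upwards [ae_muLog] with t ht
    refine (avg_le hδ ht F hF _ le_top).trans ?_
    rw [eLpNorm_exponent_top, eLpNorm_exponent_top]
    exact eLpNormEssSup_mono_measure _ (ac_t ht)
  · have h0 : θ ≠ 0 := by
      rintro rfl
      simp at hθ
    have hp : 0 < θ.toReal := ENNReal.toReal_pos h0 h
    rw [eLpNorm_eq_lintegral_rpow_enorm_toReal h0 h, ← kern_tonelli hδ _ F hF]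
    refine ENNReal.rpow_le_rpow ?_ (by positivity)
    apply lintegral_mono_ae
    filter_upwards [ae_muLog] with t ht
    have h1 := avg_le hδ ht F hF θ hθ
    rw [eLpNorm_eq_lintegral_rpow_enorm_toReal h0 h,
      lintegral_withDensity_eq_lintegral_mul _ (by fun_prop) (by fun_prop)] at h1
    rw [one_div, ENNReal.le_rpow_inv_iff hp] at h1
    refine h1.trans (le_of_eq ?_)
    have h2 : ∀ u, kern δ θ.toReal F t u = (Ioi t).indicator (fun u =>
        ENNReal.ofReal (δ * t ^ δ * u ^ (-δ - 1)) * ‖F u‖ₑ ^ θ.toReal) u := by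
      intro u
      simp [kern, indicator]
    simp only [h2]
    rw [setLIntegral_indicator measurableSet_Ioi,
      inter_eq_left.2 (Ioi_subset_Ioi ht.le)]
    rfl

lemma calLE_mono (θ : ℝ≥0∞) {f g : ℝ → ℝ≥0∞} (h : ∀ t, 0 < t → f t ≤ g t) :
    calLE θ f ≤ calLE θ g := by
  unfold calLE
  split_ifs with hh
  · refine essSup_mono_ae ?_
    filter_upwards [ae_muLog] with t ht using h t ht
  · refine ENNReal.rpow_le_rpow ?_ (by positivity)
    apply lintegral_mono_ae
    filter_upwards [ae_muLog] with t ht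
    exact ENNReal.rpow_le_rpow (h t ht) (by positivity)

lemma calL_congr (θ : ℝ≥0∞) {f g : ℝ → ℝ} (h : ∀ t, 0 < t → f t = g t) :
    calL θ f = calL θ g :=
  le_antisymm (calLE_mono θ fun t ht => by rw [h t ht]) (calLE_mono θ fun t ht => by rw [h t ht])

lemma calLE_const_mul (θ : ℝ≥0∞) (hθ : 1 ≤ θ) (c : ℝ≥0∞) (hc : c ≠ ∞) (f : ℝ → ℝ≥0∞) :
    calLE θ (fun t => c * f t) = c * calLE θ f := by
  unfold calLE
  split_ifs with hh
  · exact ENNReal.essSup_const_mul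
  · have h0 : θ ≠ 0 := by
      rintro rfl
      simp at hθ
    have hp : 0 < θ.toReal := ENNReal.toReal_pos h0 hh
    simp_rw [ENNReal.mul_rpow_of_nonneg _ _ hp.le]
    rw [lintegral_const_mul' _ _ (ENNReal.rpow_ne_top_of_nonneg hp.le hc),
      ENNReal.mul_rpow_of_nonneg _ _ (by positivity), ← ENNReal.rpow_mul,
      mul_one_div_cancel hp.ne', ENNReal.rpow_one]

lemma main_aux (α : ℝ) (hα : 0 < α) (θ : ℝ≥0∞) (hθ : 1 ≤ θ) (δ : ℝ) (hδ : 0 < δ)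
    (ψ : ℝ → ℝ) (h0 : ∀ t, 0 ≤ ψ t) (hm : Monotone ψ)
    (hfin : calL θ (fun t => t ^ (-α) * ψ t) < ∞) (φ₁ : ℝ → ℝ)
    (hφ : ∀ t, 0 < t →
      φ₁ t = (α + δ) * t ^ (α + δ) * ∫ u in Set.Ioi t, u ^ (-α - δ) * ψ u / u) :
    AntitoneOn (fun t => φ₁ t * t ^ (-α - δ)) (Set.Ioi 0) ∧
          (∀ t, 0 < t → ψ t ≤ φ₁ t) ∧
          calL θ (fun t => t ^ (-α) * φ₁ t) ≤
            ENNReal.ofReal ((α + δ) / δ) * calL θ (fun t => t ^ (-α) * ψ t) := by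
  have hψm : Measurable ψ := hm.measurable
  obtain ⟨K, hK, hb⟩ := bound_psi α hα θ hθ ψ h0 hm hfin
  have hint : ∀ t, 0 < t → IntegrableOn (fun u => u ^ (-α - δ) * ψ u / u) (Ioi t) := by
    intro t ht
    refine Integrable.mono' ((integrableOn_Ioi_rpow_of_lt (a := -δ - 1) (by linarith) ht).const_mul K)
      (Measurable.aestronglyMeasurable (by fun_prop)) ?_
    filter_upwards [ae_restrict_mem measurableSet_Ioi] with u hu
    have hu : 0 < u := ht.trans hu
    rw [Real.norm_of_nonneg (div_nonneg (mul_nonneg (by positivity) (h0 u)) hu.le)]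
    calc u ^ (-α - δ) * ψ u / u ≤ u ^ (-α - δ) * (K * u ^ α) / u := by
          gcongr; exact hb u hu
      _ = K * (u ^ (-α - δ) * u ^ α) / u := by ring
      _ = K * u ^ (-δ - 1) := by
          rw [← Real.rpow_add hu, Real.rpow_sub_one hu.ne', mul_div_assoc]
          congr 3; ring
  have hcancel : ∀ t : ℝ, 0 < t → t ^ (α + δ) * t ^ (-α - δ) = 1 := by
    intro t ht
    rw [← Real.rpow_add ht]
    simp
  refine ⟨?_, ?_, ?_⟩
  · intro s hs t ht hst
    have hs : 0 < s := hs
    have ht : 0 < t := ht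
    have e : ∀ r, 0 < r → φ₁ r * r ^ (-α - δ) =
        (α + δ) * ∫ u in Set.Ioi r, u ^ (-α - δ) * ψ u / u := by
      intro r hr
      rw [hφ r hr]
      linear_combination ((α + δ) * ∫ u in Set.Ioi r, u ^ (-α - δ) * ψ u / u) * hcancel r hr
    simp only [e s hs, e t ht]
    refine mul_le_mul_of_nonneg_left ?_ (by positivity)
    refine setIntegral_mono_set (hint s hs) ?_ (Ioi_subset_Ioi hst).eventuallyLE
    filter_upwards [ae_restrict_mem measurableSet_Ioi] with u hu
    have hu : 0 < u := hs.trans hu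
    exact div_nonneg (mul_nonneg (by positivity) (h0 u)) hu.le
  · intro t ht
    have h1 : ∫ u in Ioi t, ψ t * u ^ (-α - δ - 1) ≤ ∫ u in Set.Ioi t, u ^ (-α - δ) * ψ u / u := by
      refine setIntegral_mono_on ((integrableOn_Ioi_rpow_of_lt (by linarith) ht).const_mul _)
        (hint t ht) measurableSet_Ioi ?_
      intro u hu
      have hu' : 0 < u := ht.trans hu
      rw [Real.rpow_sub_one hu'.ne', mul_comm, div_mul_eq_mul_div]
      gcongr
      exact hm (le_of_lt hu)
    rw [integral_const_mul, integral_Ioi_rpow_of_lt (by linarith) ht] at h1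
    have h3 : -α - δ - 1 + 1 = -α - δ := by ring
    rw [h3] at h1
    rw [hφ t ht]
    calc ψ t = (α + δ) * t ^ (α + δ) * (ψ t * (-t ^ (-α - δ) / (-α - δ))) := by
          have h4 : -t ^ (-α - δ) / (-α - δ) = t ^ (-α - δ) / (α + δ) := by
            rw [← neg_div_neg_eq]; congr 1 <;> ring
          rw [h4]
          have : α + δ ≠ 0 := by positivity
          field_simp
          rw [mul_assoc, hcancel t ht, mul_one]
      _ ≤ _ := by gcongr
  · set F : ℝ → ℝ := fun t => t ^ (-α) * ψ t with hFdef
    have hF : Measurable F := by fun_prop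
    calc calL θ (fun t => t ^ (-α) * φ₁ t)
        ≤ calLE θ (fun t => ENNReal.ofReal ((α + δ) / δ) * avg δ F t) := by
          apply calLE_mono
          intro t ht
          have h5 : t ^ (-α) * φ₁ t = (α + δ) / δ *
              ∫ u in Ioi t, δ * t ^ δ * u ^ (-δ - 1) * F u := by
            rw [hφ t ht]
            have : ∫ u in Ioi t, δ * t ^ δ * u ^ (-δ - 1) * F u =
                ∫ u in Ioi t, δ * t ^ δ * (u ^ (-α - δ) * ψ u / u) := by
              apply setIntegral_congr_fun measurableSet_Ioi
              intro u hu
              have hu : 0 < u := ht.trans hu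
              have h6 : u ^ (-α - δ) = u ^ (-δ) * u ^ (-α) := by
                rw [← Real.rpow_add hu]; congr 1; ring
              simp only [hFdef]
              rw [Real.rpow_sub_one hu.ne', h6]
              ring
            rw [this, integral_const_mul]
            have h7 : t ^ δ = t ^ (-α) * t ^ (α + δ) := by
              rw [← Real.rpow_add ht]; congr 1; ring
            rw [h7]
            field_simp
          rw [← Real.enorm_eq_ofReal_abs]
          simp only []
          rw [h5, enorm_mul,
            Real.enorm_eq_ofReal (by positivity : 0 ≤ (α + δ) / δ)]
          gcongr
          refine (enorm_integral_le_lintegral_enorm _).trans (le_of_eq ?_)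
          apply setLIntegral_congr_fun measurableSet_Ioi
          intro u hu
          have hu : 0 < u := ht.trans hu
          simp only []
          rw [enorm_mul, Real.enorm_eq_ofReal (by positivity)]
      _ = ENNReal.ofReal ((α + δ) / δ) * calLE θ (avg δ F) :=
          calLE_const_mul θ hθ _ ENNReal.ofReal_ne_top _
      _ ≤ _ := by
          rw [calL_eq θ hθ]
          gcongr
          exact avg_norm hδ F hF θ hθ

/-- properties of the explicit majorant
`φ₁(t) = (α+δ) t^{α+δ} ∫_t^∞ u^{-α-δ} ψ(u) du/u`. -/
theorem stmt2 (α : ℝ) (hα : 0 < α) (θ : ℝ≥0∞) (hθ : 1 ≤ θ) (δ : ℝ) (hδ : 0 < δ) :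
    ∃ c : ℝ, 0 < c ∧
      ∀ ψ : ℝ → ℝ, (∀ t, 0 < t → 0 ≤ ψ t) → MonotoneOn ψ (Set.Ioi 0) →
        calL θ (fun t => t ^ (-α) * ψ t) < ∞ →
        ∀ φ₁ : ℝ → ℝ,
        (∀ t, φ₁ t = (α + δ) * t ^ (α + δ) * ∫ u in Set.Ioi t, u ^ (-α - δ) * ψ u / u) →
          AntitoneOn (fun t => φ₁ t * t ^ (-α - δ)) (Set.Ioi 0) ∧
          (∀ t, 0 < t → ψ t ≤ φ₁ t) ∧
          calL θ (fun t => t ^ (-α) * φ₁ t) ≤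
            ENNReal.ofReal c * calL θ (fun t => t ^ (-α) * ψ t) := by
  refine ⟨(α + δ) / δ, by positivity, ?_⟩
  intro ψ h0 hm hfin φ₁ hφ
  set ψ' : ℝ → ℝ := (Ioi (0:ℝ)).indicator ψ with hψ'
  have heq : ∀ t, 0 < t → ψ' t = ψ t := fun t ht => indicator_of_mem (mem_Ioi.2 ht) _
  have h0' : ∀ t, 0 ≤ ψ' t := fun t => indicator_nonneg (fun t ht => h0 t ht) t
  have hm' : Monotone ψ' := by
    intro s t hst
    by_cases hs : 0 < s
    · rw [heq s hs, heq t (hs.trans_le hst)]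
      exact hm hs (hs.trans_le hst) hst
    · have : ψ' s = 0 := indicator_of_notMem (by simpa using hs) _
      rw [this]
      exact h0' t
  have hc : calL θ (fun t => t ^ (-α) * ψ' t) = calL θ (fun t => t ^ (-α) * ψ t) :=
    calL_congr θ fun t ht => by rw [heq t ht]
  have key := main_aux α hα θ hθ δ hδ ψ' h0' hm' (by rw [hc]; exact hfin) φ₁ (by
    intro t ht
    rw [hφ t]
    congr 1
    apply setIntegral_congr_fun measurableSet_Ioi
    intro u hu
    simp only []
    rw [heq u (ht.trans hu)])
  rw [hc] at key
  exact ⟨key.1, fun t ht => by rw [← heq t ht]; exact key.2.1 t ht, key.2.2⟩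

end
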